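/- Suppose in addition that there are real numbers s and t with t ≠ 0 such that s_i = s and t_i = t for all i ≥ 1. Fix real numbers α, β, γ, and for n ≥ 1 set D_n := t_0^{−(n−1)}·t^{−(n−1)(n−2)/2} · det(αβγ·m_{i+j} + (αβ+βγ+γα)·m_{i+j+1} + (α+β+γ)·m_{i+j+2} + m_{i+j+3})_{i,j=0}^{n−1}. Then the sequence (D_n) satisfies a linear recurrence of order 8 with constant coefficients: there exist real numbers c_1, ..., c_8 (independent of n) such that D_n = c_1·D_{n−1} + c_2·D_{n−2} + ... + c_8·D_{n−8} for all n ≥ 9. -/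

import Mathlib

/-- `motzkinGF s t n k` is the weighted Motzkin path generating function `m(n,k)`. -/
def motzkinGF (s t : ℕ → ℝ) : ℕ → ℤ → ℝ
  | 0, k => if k = 0 then 1 else 0
  | n+1, k =>
      if k < 0 then 0
      else motzkinGF s t n (k-1) + s k.toNat * motzkinGF s t n k
             + t k.toNat * motzkinGF s t n (k+1)

/-- The scaled Hankel determinant `D_n = t_0^{-(n-1)} t^{-(n-1)(n-2)/2}` times
`det(αβγ m_{i+j} + (αβ+βγ+γα) m_{i+j+1} + (α+β+γ) m_{i+j+2} + m_{i+j+3})_{i,j=0}^{n-1}`. -/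
noncomputable def scaledHankel4 (s t : ℕ → ℝ) (tc α β γ : ℝ) (n : ℕ) : ℝ :=
  (t 0) ^ (-((n : ℤ) - 1)) * tc ^ (-(((n - 1).choose 2 : ℕ) : ℤ))
    * Matrix.det (Matrix.of fun i j : Fin n =>
        α * β * γ * motzkinGF s t ((i : ℕ) + (j : ℕ)) 0
          + (α * β + β * γ + γ * α) * motzkinGF s t ((i : ℕ) + (j : ℕ) + 1) 0
          + (α + β + γ) * motzkinGF s t ((i : ℕ) + (j : ℕ) + 2) 0
          + motzkinGF s t ((i : ℕ) + (j : ℕ) + 3) 0)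

section

open Polynomial Matrix

/-- The monic orthogonal polynomials attached to the weights `s`, `t`. -/
noncomputable def motzkinPoly (s t : ℕ → ℝ) : ℕ → ℝ[X]
  | 0 => 1
  | 1 => X - C (s 0)
  | n + 2 => (X - C (s (n + 1))) * motzkinPoly s t (n + 1) - C (t n) * motzkinPoly s t n

/-- The linear functional on polynomials with moments `m(n,0)`. -/
noncomputable def motzkinFunctional (s t : ℕ → ℝ) : ℝ[X] →ₗ[ℝ] ℝ :=
  Polynomial.lsum fun n => motzkinGF s t n 0 • LinearMap.id

lemma motzkinFunctional_X_pow (s t : ℕ → ℝ) (n : ℕ) :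
    motzkinFunctional s t (X ^ n) = motzkinGF s t n 0 := by
  simp [motzkinFunctional, Polynomial.lsum_apply, ← monomial_one_right_eq_X_pow,
    Polynomial.sum_monomial_index]

lemma motzkinGF_of_neg (s t : ℕ → ℝ) (n : ℕ) {k : ℤ} (hk : k < 0) : motzkinGF s t n k = 0 := by
  cases n with
  | zero => simp [motzkinGF, hk.ne]
  | succ n => simp [motzkinGF, hk]

lemma motzkinGF_succ (s t : ℕ → ℝ) (n k : ℕ) :
    motzkinGF s t (n + 1) k = motzkinGF s t n ((k : ℤ) - 1) + s k * motzkinGF s t n k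
      + t k * motzkinGF s t n ((k : ℤ) + 1) := by
  rw [motzkinGF, if_neg (by lia), Int.toNat_natCast]

lemma motzkinGF_of_lt (s t : ℕ → ℝ) (n : ℕ) {k : ℤ} (hk : (n : ℤ) < k) :
    motzkinGF s t n k = 0 := by
  induction n generalizing k with
  | zero => simp only [motzkinGF]; rw [if_neg (by lia)]
  | succ n ih =>
    rw [motzkinGF, if_neg (by lia), ih (by lia), ih (by lia), ih (by lia)]
    simp

lemma motzkinGF_self (s t : ℕ → ℝ) (n : ℕ) : motzkinGF s t n n = 1 := by
  induction n with
  | zero => simp [motzkinGF]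
  | succ n ih =>
    rw [motzkinGF_succ, motzkinGF_of_lt s t n (k := ((n + 1 : ℕ) : ℤ)) (by lia),
      motzkinGF_of_lt s t n (k := ((n + 1 : ℕ) : ℤ) + 1) (by lia)]
    simpa using ih

lemma motzkinFunctional_X_pow_mul_motzkinPoly (s t : ℕ → ℝ) (k n : ℕ) :
    motzkinFunctional s t (X ^ n * motzkinPoly s t k)
      = (∏ l ∈ Finset.range k, t l) * motzkinGF s t n k := by
  induction k using Nat.strong_induction_on generalizing n with
  | _ k ih =>
    match k with
    | 0 => simp [motzkinPoly, motzkinFunctional_X_pow]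
    | 1 =>
      have e : (X ^ n * motzkinPoly s t 1 : ℝ[X]) = X ^ (n + 1) - s 0 • X ^ n := by
        rw [motzkinPoly, smul_eq_C_mul]; ring
      rw [e, map_sub, map_smul, motzkinFunctional_X_pow, motzkinFunctional_X_pow]
      have h := motzkinGF_succ s t n 0
      rw [motzkinGF_of_neg s t n (k := ((0 : ℕ) : ℤ) - 1) (by simp)] at h
      simp only [Nat.cast_zero, zero_add] at h
      simp [h]
    | k + 2 =>
      have e : (X ^ n * motzkinPoly s t (k + 2) : ℝ[X])
          = X ^ (n + 1) * motzkinPoly s t (k + 1) - s (k + 1) • (X ^ n * motzkinPoly s t (k + 1))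
            - t k • (X ^ n * motzkinPoly s t k) := by
        rw [motzkinPoly, smul_eq_C_mul, smul_eq_C_mul]; ring
      rw [e, map_sub, map_sub, map_smul, map_smul, ih (k + 1) (by lia), ih (k + 1) (by lia),
        ih k (by lia), motzkinGF_succ, Finset.prod_range_succ _ (k + 1), Finset.prod_range_succ _ k]
      have h1 : ((k + 1 : ℕ) : ℤ) - 1 = k := by push_cast; ring
      have h2 : ((k + 1 : ℕ) : ℤ) + 1 = (k + 2 : ℕ) := by push_cast; ring
      rw [h1, h2, smul_eq_mul, smul_eq_mul]
      ring

lemma motzkinPoly_monic_natDegree (s t : ℕ → ℝ) (n : ℕ) :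
    (motzkinPoly s t n).Monic ∧ (motzkinPoly s t n).natDegree = n := by
  induction n using Nat.strong_induction_on with
  | _ n ih =>
    match n with
    | 0 => simp [motzkinPoly]
    | 1 => exact ⟨monic_X_sub_C _, natDegree_X_sub_C _⟩
    | n + 2 =>
      obtain ⟨hm, hd⟩ := ih (n + 1) (by lia)
      obtain ⟨hm', hd'⟩ := ih n (by lia)
      have h1 : ((X - C (s (n + 1))) * motzkinPoly s t (n + 1)).Monic := (monic_X_sub_C _).mul hm
      have h2 : ((X - C (s (n + 1))) * motzkinPoly s t (n + 1)).natDegree = n + 2 := by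
        rw [(monic_X_sub_C _).natDegree_mul hm, hd, natDegree_X_sub_C]; ring
      have h3 : (C (t n) * motzkinPoly s t n).natDegree
          < ((X - C (s (n + 1))) * motzkinPoly s t (n + 1)).natDegree := by
        have := natDegree_C_mul_le (t n) (motzkinPoly s t n)
        lia
      rw [motzkinPoly]
      exact ⟨h1.sub_of_left (degree_lt_degree h3), by
        rw [natDegree_sub_eq_left_of_natDegree_lt h3, h2]⟩

/-- Changing from the monomial basis to another monic graded basis does not change the
determinant of a family of functionals. -/
lemma det_functionals_eq_of_monic {N : ℕ} (φ : Fin N → ℝ[X] →ₗ[ℝ] ℝ) (p : Fin N → ℝ[X])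
    (hd : ∀ j, (p j).natDegree = j) (hm : ∀ j, (p j).Monic) :
    (Matrix.of fun i j => φ i (p j)).det = (Matrix.of fun i j : Fin N => φ i (X ^ (j : ℕ))).det := by
  have e : (Matrix.of fun i j => φ i (p j))
      = (Matrix.of fun i j : Fin N => φ i (X ^ (j : ℕ)))
        * Matrix.of fun (i j : Fin N) => (p j).coeff i := by
    ext i j
    rw [Matrix.mul_apply]
    conv_lhs => rw [Matrix.of_apply, (p j).as_sum_range_C_mul_X_pow' (n := N) (by rw [hd]; exact j.2),
      map_sum, ← Fin.sum_univ_eq_sum_range (fun k => φ i (C ((p j).coeff k) * X ^ k))]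
    refine Finset.sum_congr rfl fun k _ => ?_
    rw [← smul_eq_C_mul, map_smul, smul_eq_mul, mul_comm]; rfl
  rw [e, Matrix.det_mul, Matrix.det_matrixOfPolynomials p hd hm, mul_one]

lemma val_finRotate_pow_three (n : ℕ) (k : Fin (n + 3)) :
    (((finRotate (n + 3)) ^ 3) k : ℕ) = if (k : ℕ) < n then (k : ℕ) + 3 else (k : ℕ) - n := by
  have h : ∀ k : Fin (n + 3), ((finRotate (n + 3) k : Fin (n + 3)) : ℕ)
      = if (k : ℕ) = n + 2 then 0 else (k : ℕ) + 1 := by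
    intro k
    split_ifs with hk
    · rw [show k = Fin.last (n + 2) from Fin.ext hk, finRotate_last]; rfl
    · exact coe_finRotate_of_ne_last fun h => hk (by rw [h]; rfl)
  have := k.2
  simp only [pow_succ, pow_zero, one_mul, Equiv.Perm.mul_apply, h]
  split_ifs <;> lia

lemma sign_finRotate_pow_three (n : ℕ) :
    ((Equiv.Perm.sign ((finRotate (n + 3)) ^ 3) : ℤ) : ℝ) = (-1) ^ n := by
  rw [map_pow, sign_finRotate]
  push_cast
  rw [← pow_mul, show (n + 2) * 3 = n + 2 * (n + 3) by lia, pow_add, pow_mul]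
  norm_num

/-- Christoffel's formula for a cubic weight. -/
lemma det_functional_mul_vandermonde (s t : ℕ → ℝ) (x : Fin 3 → ℝ) (n : ℕ) :
    (Matrix.of fun i j : Fin n =>
        motzkinFunctional s t ((∏ l, (X - C (x l))) * X ^ ((i : ℕ) + (j : ℕ)))).det
      * (Matrix.vandermonde x).det
    = (-1) ^ n * (∏ i : Fin n, ∏ l ∈ Finset.range i, t l)
      * (Matrix.of fun i j : Fin 3 => (motzkinPoly s t (n + j)).eval (x i)).det := by
  set q : ℝ[X] := ∏ l, (X - C (x l)) with hq
  have hqm : q.Monic := monic_prod_of_monic _ _ fun l _ => monic_X_sub_C _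
  have hqd : q.natDegree = 3 := by
    rw [hq, natDegree_prod_of_monic _ _ fun l _ => monic_X_sub_C _]; simp
  have hqe : ∀ i, q.eval (x i) = 0 := fun i => by
    rw [hq, eval_prod]; exact Finset.prod_eq_zero (Finset.mem_univ i) (by simp)
  let φ : Fin (n + 3) → ℝ[X] →ₗ[ℝ] ℝ := Fin.append
    (fun i : Fin n => motzkinFunctional s t ∘ₗ LinearMap.mulLeft ℝ (X ^ (i : ℕ)))
    (fun i : Fin 3 => Polynomial.leval (x i))
  let r : Fin (n + 3) → ℝ[X] := fun j => if (j : ℕ) < 3 then X ^ (j : ℕ) else q * X ^ ((j : ℕ) - 3)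
  have h1 := det_functionals_eq_of_monic φ (fun j => motzkinPoly s t j)
    (fun j => (motzkinPoly_monic_natDegree s t j).2) (fun j => (motzkinPoly_monic_natDegree s t j).1)
  have h2 := det_functionals_eq_of_monic φ r
    (fun j => by
      simp only [r]
      split_ifs with h
      · simp
      · rw [hqm.natDegree_mul (monic_X_pow _), hqd, natDegree_X_pow]; lia)
    (fun j => by
      simp only [r]
      split_ifs with h
      · exact monic_X_pow _
      · exact hqm.mul (monic_X_pow _))
  have h3 := Matrix.det_permute' ((finRotate (n + 3)) ^ 3) (Matrix.of fun i j => φ i (r j))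
  rw [sign_finRotate_pow_three, h2, ← h1] at h3
  rw [← Matrix.det_submatrix_equiv_self finSumFinEquiv,
    ← Matrix.det_submatrix_equiv_self finSumFinEquiv
      (Matrix.of fun i j : Fin (n + 3) => φ i (motzkinPoly s t j))] at h3
  have e1 : ((Matrix.of fun i j : Fin (n + 3) => φ i (motzkinPoly s t j)).submatrix
      finSumFinEquiv finSumFinEquiv) = Matrix.fromBlocks
        (Matrix.of fun i j : Fin n => (∏ l ∈ Finset.range (j : ℕ), t l) * motzkinGF s t i (j : ℕ)) 0
        (Matrix.of fun (i : Fin 3) (j : Fin n) => (motzkinPoly s t j).eval (x i))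
        (Matrix.of fun i j : Fin 3 => (motzkinPoly s t (n + j)).eval (x i)) := by
    ext i j
    rcases i with i | i <;> rcases j with j | j
    · simp [φ, motzkinFunctional_X_pow_mul_motzkinPoly]
    · have : motzkinGF s t i ((n : ℤ) + j) = 0 := motzkinGF_of_lt s t i (by have := i.2; lia)
      simp [φ, motzkinFunctional_X_pow_mul_motzkinPoly, this]
    · simp [φ]
    · simp [φ]
  have e2 : (((Matrix.of fun i j => φ i (r j)).submatrix id ⇑((finRotate (n + 3)) ^ 3)).submatrix
      finSumFinEquiv finSumFinEquiv) = Matrix.fromBlocks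
        (Matrix.of fun i j : Fin n => motzkinFunctional s t (q * X ^ ((i : ℕ) + (j : ℕ))))
        (Matrix.of fun (i : Fin n) (j : Fin 3) => motzkinFunctional s t (X ^ ((i : ℕ) + (j : ℕ)))) 0
        (Matrix.vandermonde x) := by
    ext i j
    have hr : ∀ k : Fin (n + 3), r (((finRotate (n + 3)) ^ 3) k)
        = if (k : ℕ) < n then q * X ^ (k : ℕ) else X ^ ((k : ℕ) - n) := by
      intro k
      have := k.2
      simp only [r, val_finRotate_pow_three]
      by_cases hk : (k : ℕ) < n
      · simp [hk]
      · rw [if_neg hk, if_neg hk, if_pos (by lia)]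
    rw [Matrix.submatrix_apply, Matrix.submatrix_apply, Matrix.of_apply, hr]
    rcases i with i | i <;> rcases j with j | j
    · simp [φ, pow_add, mul_left_comm]
    · simp [φ, pow_add]
    · simp [φ, hqe]
    · simp [φ, Matrix.vandermonde_apply]
  have e3 : (Matrix.of fun i j : Fin n =>
      (∏ l ∈ Finset.range (j : ℕ), t l) * motzkinGF s t i (j : ℕ)).det
      = ∏ i : Fin n, ∏ l ∈ Finset.range i, t l := by
    rw [Matrix.det_of_isLowerTriangular]
    · simp [motzkinGF_self]
    · intro i j hij
      rw [Matrix.of_apply, motzkinGF_of_lt s t i (by simpa using hij), mul_zero]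
  rw [e1, e2, Matrix.det_fromBlocks_zero₁₂, Matrix.det_fromBlocks_zero₂₁, e3] at h3
  rw [h3]; ring

/-- The second elementary symmetric function of the eight products `λμν`, where `λ`, `μ`, `ν` are
roots of `z² - az + d`, `z² - bz + d`, `z² - cz + d` respectively. -/
def tripleRootEsymmTwo (a b c d : ℝ) : ℝ :=
  d * (a ^ 2 * b ^ 2 + b ^ 2 * c ^ 2 + c ^ 2 * a ^ 2) - 2 * d ^ 2 * (a ^ 2 + b ^ 2 + c ^ 2)
    + 4 * d ^ 3

/-- The third elementary symmetric function of the products `λμν`. -/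
def tripleRootEsymmThree (a b c d : ℝ) : ℝ :=
  a * b * c * (d ^ 2 * (a ^ 2 + b ^ 2 + c ^ 2) - 5 * d ^ 3)

/-- The fourth elementary symmetric function of the products `λμν`. -/
def tripleRootEsymmFour (a b c d : ℝ) : ℝ :=
  d ^ 3 * (a * b * c) ^ 2 + d ^ 4 * (a ^ 2 + b ^ 2 + c ^ 2) ^ 2 + 6 * d ^ 6
    - 2 * d ^ 4 * (a ^ 2 * b ^ 2 + b ^ 2 * c ^ 2 + c ^ 2 * a ^ 2)
    - 4 * d ^ 5 * (a ^ 2 + b ^ 2 + c ^ 2)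

/-- The product of three solutions of second order recurrences sharing the constant `d`
satisfies a recurrence of order eight. -/
lemma product_three_recurrence {a b c d : ℝ} {u v w : ℕ → ℝ}
    (hu : ∀ n, u (n + 2) = a * u (n + 1) - d * u n)
    (hv : ∀ n, v (n + 2) = b * v (n + 1) - d * v n)
    (hw : ∀ n, w (n + 2) = c * w (n + 1) - d * w n)
    (i j k : ℕ) :
    u (i + 8) * v (j + 8) * w (k + 8)
      = a * b * c * (u (i + 7) * v (j + 7) * w (k + 7))
        - tripleRootEsymmTwo a b c d * (u (i + 6) * v (j + 6) * w (k + 6))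
        + tripleRootEsymmThree a b c d * (u (i + 5) * v (j + 5) * w (k + 5))
        - tripleRootEsymmFour a b c d * (u (i + 4) * v (j + 4) * w (k + 4))
        + d ^ 3 * tripleRootEsymmThree a b c d * (u (i + 3) * v (j + 3) * w (k + 3))
        - d ^ 6 * tripleRootEsymmTwo a b c d * (u (i + 2) * v (j + 2) * w (k + 2))
        + d ^ 9 * (a * b * c) * (u (i + 1) * v (j + 1) * w (k + 1))
        - d ^ 12 * (u i * v j * w k) := by
  simp only [hu, hv, hw, tripleRootEsymmTwo, tripleRootEsymmThree, tripleRootEsymmFour]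
  ring

/-- The `3 × 3` Casorati determinant of three solutions of second order recurrences sharing the
constant `d` satisfies a recurrence of order eight. -/
lemma casoratian_three_recurrence {d : ℝ} {a : Fin 3 → ℝ} {u : Fin 3 → ℕ → ℝ}
    (hu : ∀ i n, u i (n + 2) = a i * u i (n + 1) - d * u i n) (E : ℕ → ℝ)
    (hE : ∀ n, E n = (Matrix.of fun i j : Fin 3 => u i (n + j)).det) (n : ℕ) :
    E (n + 8) = a 0 * a 1 * a 2 * E (n + 7)
      - tripleRootEsymmTwo (a 0) (a 1) (a 2) d * E (n + 6)
      + tripleRootEsymmThree (a 0) (a 1) (a 2) d * E (n + 5)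
      - tripleRootEsymmFour (a 0) (a 1) (a 2) d * E (n + 4)
      + d ^ 3 * tripleRootEsymmThree (a 0) (a 1) (a 2) d * E (n + 3)
      - d ^ 6 * tripleRootEsymmTwo (a 0) (a 1) (a 2) d * E (n + 2)
      + d ^ 9 * (a 0 * a 1 * a 2) * E (n + 1) - d ^ 12 * E n := by
  have h := product_three_recurrence (hu 0) (hu 1) (hu 2)
  have hE' : ∀ k, E (n + k)
      = u 0 (n + k) * u 1 (n + 1 + k) * u 2 (n + 2 + k)
        - u 0 (n + k) * u 1 (n + 2 + k) * u 2 (n + 1 + k)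
        - u 0 (n + 1 + k) * u 1 (n + k) * u 2 (n + 2 + k)
        + u 0 (n + 2 + k) * u 1 (n + k) * u 2 (n + 1 + k)
        + u 0 (n + 1 + k) * u 1 (n + 2 + k) * u 2 (n + k)
        - u 0 (n + 2 + k) * u 1 (n + 1 + k) * u 2 (n + k) := by
    intro k
    rw [hE, Matrix.det_fin_three]
    simp only [Matrix.of_apply, Fin.val_zero, Fin.val_one, Fin.val_two, add_zero,
      Nat.add_right_comm n _ k]
    ring
  have h0 := hE' 0
  simp only [add_zero] at h0
  rw [h0]
  simp only [hE']
  linear_combination h n (n + 1) (n + 2) - h n (n + 2) (n + 1) - h (n + 1) n (n + 2)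
    + h (n + 2) n (n + 1) + h (n + 1) (n + 2) n - h (n + 2) (n + 1) n

lemma prod_prod_range_of_eventually_const {t : ℕ → ℝ} {tc : ℝ} (htt : ∀ i, 1 ≤ i → t i = tc)
    (m : ℕ) :
    ∏ i ∈ Finset.range (m + 1), ∏ l ∈ Finset.range i, t l = t 0 ^ m * tc ^ m.choose 2 := by
  induction m with
  | zero => simp
  | succ m ih =>
    have h : ∏ l ∈ Finset.range (m + 1), t l = t 0 * tc ^ m := by
      rw [Finset.prod_range_succ', Finset.prod_congr rfl fun i _ => htt (i + 1) (by lia)]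
      simp [mul_comm]
    rw [Finset.prod_range_succ, ih, h, Nat.choose_succ_succ' m 1, Nat.choose_one_right]
    ring

lemma scaledHankel4_mul_vandermonde {s t : ℕ → ℝ} {tc : ℝ} (ht : t 0 ≠ 0) (htc : tc ≠ 0)
    (htt : ∀ i, 1 ≤ i → t i = tc) (α β γ : ℝ) (m : ℕ) :
    scaledHankel4 s t tc α β γ (m + 1) * (Matrix.vandermonde ![-α, -β, -γ]).det
      = (-1) ^ (m + 1) * (Matrix.of fun i j : Fin 3 =>
          (motzkinPoly s t (m + j + 1)).eval (![-α, -β, -γ] i)).det := by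
  have h := det_functional_mul_vandermonde s t ![-α, -β, -γ] (m + 1)
  rw [Fin.prod_univ_eq_prod_range (fun i => ∏ l ∈ Finset.range i, t l),
    prod_prod_range_of_eventually_const htt] at h
  have hL : ∀ n : ℕ, motzkinFunctional s t ((∏ l, (X - C (![-α, -β, -γ] l))) * X ^ n)
      = α * β * γ * motzkinGF s t n 0 + (α * β + β * γ + γ * α) * motzkinGF s t (n + 1) 0
        + (α + β + γ) * motzkinGF s t (n + 2) 0 + motzkinGF s t (n + 3) 0 := by
    intro n
    have e : ((∏ l, (X - C (![-α, -β, -γ] l))) * X ^ n : ℝ[X])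
        = (α * β * γ) • X ^ n + (α * β + β * γ + γ * α) • X ^ (n + 1)
          + (α + β + γ) • X ^ (n + 2) + X ^ (n + 3) := by
      simp only [Fin.prod_univ_three, smul_eq_C_mul, Matrix.cons_val, map_neg, map_mul, map_add]
      ring
    rw [e]
    simp only [map_add, map_smul, motzkinFunctional_X_pow, smul_eq_mul]
  simp only [hL, Nat.add_right_comm m 1] at h
  have e1 : t 0 ^ (-(((m + 1 : ℕ) : ℤ) - 1)) = (t 0 ^ m)⁻¹ := by
    rw [Nat.cast_succ, add_sub_cancel_right, _root_.zpow_neg, zpow_natCast]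
  rw [scaledHankel4, e1, _root_.zpow_neg, zpow_natCast, Nat.add_sub_cancel, mul_assoc, h]
  field_simp

lemma scaledHankel4_recurrence_of_ne {s t : ℕ → ℝ} {sc tc : ℝ} (ht : t 0 ≠ 0) (htc : tc ≠ 0)
    (hs : ∀ i, 1 ≤ i → s i = sc) (htt : ∀ i, 1 ≤ i → t i = tc) {α β γ : ℝ}
    (hαβ : α ≠ β) (hαγ : α ≠ γ) (hβγ : β ≠ γ) (m : ℕ) (D : ℕ → ℝ)
    (hD : ∀ k, D k = scaledHankel4 s t tc α β γ k) :
    D (m + 9)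
      = -((-α - sc) * (-β - sc) * (-γ - sc)) * D (m + 8)
        + -tripleRootEsymmTwo (-α - sc) (-β - sc) (-γ - sc) tc * D (m + 7)
        + -tripleRootEsymmThree (-α - sc) (-β - sc) (-γ - sc) tc * D (m + 6)
        + -tripleRootEsymmFour (-α - sc) (-β - sc) (-γ - sc) tc * D (m + 5)
        + -(tc ^ 3 * tripleRootEsymmThree (-α - sc) (-β - sc) (-γ - sc) tc) * D (m + 4)
        + -(tc ^ 6 * tripleRootEsymmTwo (-α - sc) (-β - sc) (-γ - sc) tc) * D (m + 3)
        + -(tc ^ 9 * ((-α - sc) * (-β - sc) * (-γ - sc))) * D (m + 2)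
        + -tc ^ 12 * D (m + 1) := by
  have hV : (Matrix.vandermonde ![-α, -β, -γ]).det ≠ 0 := by
    rw [Matrix.det_vandermonde_ne_zero_iff]
    intro i j hij
    fin_cases i <;> fin_cases j <;> simp_all [eq_comm]
  set V := (Matrix.vandermonde ![-α, -β, -γ]).det
  let u : Fin 3 → ℕ → ℝ := fun i k => (motzkinPoly s t (k + 1)).eval (![-α, -β, -γ] i)
  have hu : ∀ i n, u i (n + 2) = (![-α - sc, -β - sc, -γ - sc] i) * u i (n + 1) - tc * u i n := by
    intro i n
    have e : ![-α - sc, -β - sc, -γ - sc] i = ![-α, -β, -γ] i - sc := by fin_cases i <;> rfl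
    simp only [u, e]
    rw [show n + 2 + 1 = (n + 1) + 2 from rfl, motzkinPoly, hs _ (by lia), htt _ (by lia)]
    simp
  obtain ⟨E, hE⟩ : ∃ E : ℕ → ℝ, ∀ n, E n = (Matrix.of fun i j : Fin 3 => u i (n + j)).det :=
    ⟨_, fun _ => rfl⟩
  have hrec := casoratian_three_recurrence hu E hE m
  simp only [Matrix.cons_val] at hrec
  have hDV : ∀ k, D (k + 1) * V = (-1) ^ (k + 1) * E k := fun k => by
    rw [hD, hE]; exact scaledHankel4_mul_vandermonde ht htc htt α β γ k
  refine mul_right_cancel₀ hV ?_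
  simp only [add_mul, mul_assoc, hDV]
  rw [hrec]
  ring

lemma continuous_scaledHankel4 (s t : ℕ → ℝ) (tc : ℝ) (n : ℕ) {α β γ : ℝ → ℝ}
    (hα : Continuous α) (hβ : Continuous β) (hγ : Continuous γ) :
    Continuous fun x => scaledHankel4 s t tc (α x) (β x) (γ x) n := by
  unfold scaledHankel4
  refine continuous_const.mul (Continuous.matrix_det (continuous_matrix fun i j => ?_))
  simp only [Matrix.of_apply]
  fun_prop

end

/-- Corollary 7: if `s_i = s` and `t_i = t` for `i ≥ 1` (`t ≠ 0`), the scaled Hankel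
determinants `D_n` satisfy a linear recurrence of order 8 with constant coefficients. -/
theorem scaledHankel4_linear_recurrence (s t : ℕ → ℝ) (ht : ∀ n, t n ≠ 0)
    (sc tc : ℝ) (htc : tc ≠ 0)
    (hs : ∀ i, 1 ≤ i → s i = sc) (htt : ∀ i, 1 ≤ i → t i = tc)
    (α β γ : ℝ) :
    ∃ c₁ c₂ c₃ c₄ c₅ c₆ c₇ c₈ : ℝ, ∀ n : ℕ, 9 ≤ n →
      scaledHankel4 s t tc α β γ n
        = c₁ * scaledHankel4 s t tc α β γ (n - 1)
          + c₂ * scaledHankel4 s t tc α β γ (n - 2)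
          + c₃ * scaledHankel4 s t tc α β γ (n - 3)
          + c₄ * scaledHankel4 s t tc α β γ (n - 4)
          + c₅ * scaledHankel4 s t tc α β γ (n - 5)
          + c₆ * scaledHankel4 s t tc α β γ (n - 6)
          + c₇ * scaledHankel4 s t tc α β γ (n - 7)
          + c₈ * scaledHankel4 s t tc α β γ (n - 8) := by
  refine ⟨-((-α - sc) * (-β - sc) * (-γ - sc)),
    -tripleRootEsymmTwo (-α - sc) (-β - sc) (-γ - sc) tc,
    -tripleRootEsymmThree (-α - sc) (-β - sc) (-γ - sc) tc,
    -tripleRootEsymmFour (-α - sc) (-β - sc) (-γ - sc) tc,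
    -(tc ^ 3 * tripleRootEsymmThree (-α - sc) (-β - sc) (-γ - sc) tc),
    -(tc ^ 6 * tripleRootEsymmTwo (-α - sc) (-β - sc) (-γ - sc) tc),
    -(tc ^ 9 * ((-α - sc) * (-β - sc) * (-γ - sc))), -tc ^ 12, fun n hn => ?_⟩
  obtain ⟨m, rfl⟩ := Nat.exists_eq_add_of_le' hn
  have hdense : Dense ({α - β, (α - γ) / 2, β - γ} : Set ℝ)ᶜ :=
    (Set.toFinite _).countable.dense_compl ℝ
  -- Perturb the parameters along a line on which they are generically distinct.
  have hgen := fun (ε : ℝ) (hε : ε ∈ ({α - β, (α - γ) / 2, β - γ} : Set ℝ)ᶜ) => by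
    simp only [Set.mem_compl_iff, Set.mem_insert_iff, Set.mem_singleton_iff, not_or] at hε
    exact scaledHankel4_recurrence_of_ne (ht 0) htc hs htt
      (α := α + ε) (β := β + 2 * ε) (γ := γ + 3 * ε)
      (fun h => hε.1 (by linarith)) (fun h => hε.2.1 (by linarith))
      (fun h => hε.2.2 (by linarith)) m _ (fun _ => rfl)
  have hc := fun n => continuous_scaledHankel4 s t tc n (α := fun ε => α + ε)
    (β := fun ε => β + 2 * ε) (γ := fun ε => γ + 3 * ε) (by fun_prop) (by fun_prop) (by fun_prop)
  have heq := congrFun (Continuous.ext_on hdense (hc (m + 9))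
    (by unfold tripleRootEsymmTwo tripleRootEsymmThree tripleRootEsymmFour; fun_prop) hgen) 0
  simpa using heq
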